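/- For N = 4, the product of creation operators at the singular Bethe roots ±i/2 vanishes identically: B_4(i/2)·B_4(−i/2) = 0 as an operator on 𝔥_4 = (ℂ²)^⊗4. In particular, the Bethe vector associated with the singular solution {i/2, −i/2} of the Bethe ansatz equations is the zero vector. -/

import Mathlib

open scoped TensorProduct

noncomputable section

namespace Heisenberg

/-- The state space `𝔥_N = (ℂ²)^⊗N`. -/
abbrev QState (N : ℕ) : Type := ⨂[ℂ] _i : Fin N, (Fin 2 → ℂ)

/-- The Pauli matrix `σ^x`. -/
def pauliX : Matrix (Fin 2) (Fin 2) ℂ := !![0, 1; 1, 0]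

/-- The Pauli matrix `σ^y`. -/
def pauliY : Matrix (Fin 2) (Fin 2) ℂ := !![0, -Complex.I; Complex.I, 0]

/-- The Pauli matrix `σ^z`. -/
def pauliZ : Matrix (Fin 2) (Fin 2) ℂ := !![1, 0; 0, -1]

/-- `σ^+ = σ^x + iσ^y`. -/
def pauliPlus : Matrix (Fin 2) (Fin 2) ℂ := pauliX + Complex.I • pauliY

/-- `σ^- = σ^x - iσ^y`. -/
def pauliMinus : Matrix (Fin 2) (Fin 2) ℂ := pauliX - Complex.I • pauliY

/-- `σ_k^a`: the operator acting as the 2×2 matrix `M` on the `k`-th tensor factor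
and as the identity elsewhere. -/
def siteOp (N : ℕ) (k : Fin N) (M : Matrix (Fin 2) (Fin 2) ℂ) :
    Module.End ℂ (QState N) :=
  PiTensorProduct.map (fun i => if i = k then Matrix.toLin' M else LinearMap.id)

/-- The Heisenberg Hamiltonian
`𝓗_N = (J/4)·∑_k (σ_k^x σ_{k+1}^x + σ_k^y σ_{k+1}^y + σ_k^z σ_{k+1}^z − Id)`
with periodic boundary conditions (the successor of `k` in `Fin N` is `finRotate N k`). -/
def ham (N : ℕ) (J : ℝ) : Module.End ℂ (QState N) :=
  ((J : ℂ) / 4) • ∑ k : Fin N,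
    (siteOp N k pauliX * siteOp N (finRotate N k) pauliX +
     siteOp N k pauliY * siteOp N (finRotate N k) pauliY +
     siteOp N k pauliZ * siteOp N (finRotate N k) pauliZ - 1)

/-- The total spin operator `S^a = (1/2)·∑_k σ_k^a`. -/
def spin (N : ℕ) (a : Matrix (Fin 2) (Fin 2) ℂ) : Module.End ℂ (QState N) :=
  ((1 : ℂ) / 2) • ∑ k : Fin N, siteOp N k a

/-- The Lax operator `L_k(λ)`, a 2×2 matrix with entries in `End(𝔥_N)`. -/
def lax (N : ℕ) (k : Fin N) (lam : ℂ) : Matrix (Fin 2) (Fin 2) (Module.End ℂ (QState N)) :=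
  !![lam • (1 : Module.End ℂ (QState N)) + (Complex.I / 2) • siteOp N k pauliZ,
       (Complex.I / 2) • siteOp N k pauliMinus;
     (Complex.I / 2) • siteOp N k pauliPlus,
       lam • (1 : Module.End ℂ (QState N)) - (Complex.I / 2) • siteOp N k pauliZ]

/-- The transfer matrix `T_N(λ) = L_N(λ)·L_{N−1}(λ)···L_1(λ)`. -/
def transfer (N : ℕ) (lam : ℂ) : Matrix (Fin 2) (Fin 2) (Module.End ℂ (QState N)) :=
  ((List.ofFn (fun k : Fin N => lax N k lam)).reverse).prod

/-- The creation operator `B_N(λ)`, the top-right entry of the transfer matrix. -/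
def Bop (N : ℕ) (lam : ℂ) : Module.End ℂ (QState N) := transfer N lam 0 1

/-- If `x` commutes with all entries of each matrix of a list, it commutes with all entries of
the product of the list. -/
theorem commute_list_prod_apply {m R : Type*} [Fintype m] [DecidableEq m] [Semiring R] (x : R)
    (l : List (Matrix m m R)) (h : ∀ A ∈ l, ∀ i j, Commute x (A i j)) (i j : m) :
    Commute x (l.prod i j) := by
  induction l generalizing i with
  | nil =>
    rw [List.prod_nil, Matrix.one_apply]
    split_ifs
    exacts [Commute.one_right x, Commute.zero_right x]
  | cons A l ih =>
    rw [List.prod_cons, Matrix.mul_apply]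
    exact Commute.sum_right _ _ _ fun k _ =>
      (h A (by simp) i k).mul_right (ih (fun B hB => h B (by simp [hB])) k)

theorem siteOp_mul (N : ℕ) (k : Fin N) (A B : Matrix (Fin 2) (Fin 2) ℂ) :
    siteOp N k A * siteOp N k B = siteOp N k (A * B) := by
  rw [siteOp, siteOp, siteOp, ← PiTensorProduct.map_mul]
  congr 1
  funext i
  split_ifs
  · rw [Matrix.toLin'_mul]; rfl
  · rfl

theorem siteOp_commute {N : ℕ} {k l : Fin N} (hkl : k ≠ l) (A B : Matrix (Fin 2) (Fin 2) ℂ) :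
    Commute (siteOp N k A) (siteOp N l B) := by
  rw [Commute, SemiconjBy, siteOp, siteOp, ← PiTensorProduct.map_mul, ← PiTensorProduct.map_mul]
  congr 1
  funext i
  by_cases hk : i = k
  · subst hk
    rw [if_pos rfl, if_neg hkl]
    rfl
  · rw [if_neg hk]
    rfl

theorem siteOp_one (N : ℕ) (k : Fin N) : siteOp N k 1 = 1 := by
  simp [siteOp, PiTensorProduct.map_id, Module.End.one_eq_id]

theorem siteOp_eq_mapMultilinear (N : ℕ) (k : Fin N) (A : Matrix (Fin 2) (Fin 2) ℂ) :
    siteOp N k A = PiTensorProduct.mapMultilinear ℂ (fun _ : Fin N => Fin 2 → ℂ)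
      (fun _ => Fin 2 → ℂ) (Function.update (fun _ => LinearMap.id) k (Matrix.toLin' A)) := by
  rw [siteOp, PiTensorProduct.mapMultilinear_apply]
  congr 1
  funext i
  by_cases h : i = k
  · subst h; simp
  · simp [h]

theorem siteOp_add (N : ℕ) (k : Fin N) (A B : Matrix (Fin 2) (Fin 2) ℂ) :
    siteOp N k (A + B) = siteOp N k A + siteOp N k B := by
  simp only [siteOp_eq_mapMultilinear, map_add, MultilinearMap.map_update_add]

theorem siteOp_smul (N : ℕ) (k : Fin N) (c : ℂ) (A : Matrix (Fin 2) (Fin 2) ℂ) :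
    siteOp N k (c • A) = c • siteOp N k A := by
  simp only [siteOp_eq_mapMultilinear, map_smul, MultilinearMap.map_update_smul]

theorem siteOp_zero (N : ℕ) (k : Fin N) : siteOp N k 0 = 0 := by
  simpa using siteOp_smul N k 0 0

/-- The entries of the Lax operator, as matrices acting on a single site. -/
def laxEntry (lam : ℂ) : Matrix (Fin 2) (Fin 2) (Matrix (Fin 2) (Fin 2) ℂ) :=
  !![lam • (1 : Matrix (Fin 2) (Fin 2) ℂ) + (Complex.I / 2) • pauliZ,
       (Complex.I / 2) • pauliMinus;
     (Complex.I / 2) • pauliPlus,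
       lam • (1 : Matrix (Fin 2) (Fin 2) ℂ) + (-(Complex.I / 2)) • pauliZ]

theorem lax_apply (N : ℕ) (k : Fin N) (lam : ℂ) (a b : Fin 2) :
    lax N k lam a b = siteOp N k (laxEntry lam a b) := by
  fin_cases a <;> fin_cases b <;>
    simp [lax, laxEntry, siteOp_add, siteOp_smul, siteOp_one, -neg_smul]
  module

/-- At the singular points `±i/2`, products of entries from the first rows of the Lax matrices
vanish. -/
theorem laxEntry_singular_mul (a b : Fin 2) :
    laxEntry (Complex.I / 2) 0 a * laxEntry (-(Complex.I / 2)) 0 b = 0 := by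
  fin_cases a <;> fin_cases b <;> ext i j <;> fin_cases i <;> fin_cases j <;>
    simp [laxEntry, pauliX, pauliY, pauliZ, pauliMinus, Matrix.mul_apply, Fin.sum_univ_two]

theorem transfer_succ (n : ℕ) (lam : ℂ) :
    transfer (n + 1) lam = lax (n + 1) (Fin.last n) lam *
      ((List.ofFn fun k : Fin n => lax (n + 1) k.castSucc lam).reverse).prod := by
  rw [transfer, List.ofFn_succ', List.concat_eq_append, List.reverse_append]
  simp

/-- On a chain of any positive length, the creation operators at `i/2` and `-i/2` multiply
to zero. -/
theorem Bop_singular_mul (n : ℕ) :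
    Bop (n + 1) (Complex.I / 2) * Bop (n + 1) (-(Complex.I / 2)) = 0 := by
  rw [Bop, Bop, transfer_succ, transfer_succ, Matrix.mul_apply, Matrix.mul_apply,
    Finset.sum_mul_sum]
  refine Finset.sum_eq_zero fun a _ => Finset.sum_eq_zero fun b _ => ?_
  have hcomm : Commute (lax (n + 1) (Fin.last n) (-(Complex.I / 2)) 0 b)
      (((List.ofFn fun k : Fin n =>
        lax (n + 1) k.castSucc (Complex.I / 2)).reverse).prod a 1) := by
    refine commute_list_prod_apply _ _ (fun A hA i j => ?_) a 1
    obtain ⟨k, rfl⟩ := List.mem_ofFn.mp (List.mem_reverse.mp hA)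
    rw [lax_apply, lax_apply]
    exact siteOp_commute (Fin.castSucc_lt_last k).ne' _ _
  rw [mul_assoc, ← mul_assoc _ (lax _ _ _ _ _), ← hcomm.eq, mul_assoc, ← mul_assoc,
    lax_apply, lax_apply, siteOp_mul, laxEntry_singular_mul, siteOp_zero, zero_mul]

/-- For `N = 4`, the product of creation operators at the singular Bethe roots `±i/2`
vanishes identically; in particular the Bethe vector of the singular solution
`{i/2, −i/2}` is zero. -/
theorem Bop_singular_vanishes :
    Bop 4 (Complex.I / 2) * Bop 4 (-(Complex.I / 2)) = 0 :=
  Bop_singular_mul 3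

end Heisenberg
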